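/- Let X be a Banach space and let C ⊆ X be a weakly compact, convex set having the Opial property. Suppose T : C → C is (α₁,α₂)-nonexpansive (for a multi-index (α₁,α₂) with α₁ > 0, α₂ > 0 and α₁ + α₂ = 1) and T is asymptotically regular at some point x ∈ C. Then the sequence of iterates (Tⁿx)ₙ converges weakly to a fixed point of T. -/

import Mathlib

open Filter Topology

/-- A sequence `u` converges weakly to `y` in a normed space: every continuous
linear functional of the terms converges to its value at `y`. -/
def WeakConvSeq {X : Type*} [NormedAddCommGroup X] [NormedSpace ℝ X]
    (u : ℕ → X) (y : X) : Prop :=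
  ∀ f : X →L[ℝ] ℝ, Filter.Tendsto (fun n => f (u n)) Filter.atTop (nhds (f y))

/-- A subset `C` has the Opial property: whenever a sequence in `C` converges
weakly to `u₀`, then `liminf ‖uₙ - u₀‖ < liminf ‖uₙ - v‖` for every `v ≠ u₀`. -/
def OpialSet {X : Type*} [NormedAddCommGroup X] [NormedSpace ℝ X] (C : Set X) : Prop :=
  ∀ (u : ℕ → X) (u₀ : X), (∀ n, u n ∈ C) → WeakConvSeq u u₀ →
    ∀ v : X, v ≠ u₀ →
      Filter.liminf (fun n => ‖u n - u₀‖) Filter.atTop <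
        Filter.liminf (fun n => ‖u n - v‖) Filter.atTop

section WeakCompactness

variable {X : Type*} [NormedAddCommGroup X] [NormedSpace ℝ X]

theorem weakConvSeq_iff_tendsto_toWeakSpace {u : ℕ → X} {y : X} :
    WeakConvSeq u y ↔ Tendsto (fun n => toWeakSpace ℝ X (u n)) atTop (𝓝 (toWeakSpace ℝ X y)) := by
  have hB : Function.Injective (topDualPairing ℝ X).flip :=
    (injective_iff_map_eq_zero _).2 fun z hz =>
      (SeparatingDual.eq_zero_iff_forall_dual_eq_zero (R := ℝ) z).2 fun f =>
        LinearMap.congr_fun hz f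
  exact (WeakBilin.tendsto_iff_forall_eval_tendsto (topDualPairing ℝ X).flip hB).symm

theorem continuous_toWeakSpace_symm_apply (f : X →L[ℝ] ℝ) :
    Continuous fun z : WeakSpace ℝ X => f ((toWeakSpace ℝ X).symm z) :=
  WeakBilin.eval_continuous (topDualPairing ℝ X).flip f

/-- The nonzero points of a separable set are separated from `0` by a sequence of functionals. -/
theorem TopologicalSpace.IsSeparable.exists_dual_seq_separating {M : Set X}
    (hM : TopologicalSpace.IsSeparable M) :
    ∃ f : ℕ → X →L[ℝ] ℝ, ∀ z ∈ M, (∀ n, f n z = 0) → z = 0 := by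
  obtain ⟨c, hc, hMc⟩ := hM
  rcases c.eq_empty_or_nonempty with rfl | hne
  · exact ⟨0, fun z hz => by simpa using hMc hz⟩
  obtain ⟨d, rfl⟩ := hc.exists_eq_range hne
  choose f hf hfd using fun n => exists_dual_vector'' ℝ (d n)
  refine ⟨f, fun z hz h0 => ?_⟩
  by_contra hz0
  obtain ⟨_, ⟨n, rfl⟩, hn⟩ :=
    Metric.mem_closure_iff.1 (hMc hz) (‖z‖ / 2) (half_pos (norm_pos_iff.2 hz0))
  rw [dist_eq_norm, norm_sub_rev] at hn
  have h1 : ‖d n‖ ≤ ‖d n - z‖ := by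
    have h2 : f n (d n - z) = ‖d n‖ := by rw [map_sub, h0 n, sub_zero]; exact hfd n
    rw [← h2]
    exact (le_abs_self _).trans (((f n).le_of_opNorm_le (hf n) _).trans_eq (one_mul _))
  have h3 : ‖z‖ ≤ ‖d n‖ + ‖d n - z‖ := by
    have := norm_sub_le (d n) (d n - z)
    rwa [sub_sub_cancel] at this
  linarith

/-- One half of the Eberlein–Šmulian theorem: a weakly compact set is weakly sequentially
compact. -/
theorem exists_subseq_weakConvSeq {C : Set X} (hC : IsCompact (toWeakSpace ℝ X '' C))
    {u : ℕ → X} (hu : ∀ n, u n ∈ C) :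
    ∃ y ∈ C, ∃ φ : ℕ → ℕ, StrictMono φ ∧ WeakConvSeq (fun n => u (φ n)) y := by
  let S : Submodule ℝ X := Submodule.span ℝ (Set.range u)
  let M : Submodule ℝ X := S.topologicalClosure
  have hMsep : TopologicalSpace.IsSeparable (M : Set X) :=
    ((Set.countable_range u).isSeparable.span (R := ℝ)).closure
  have hMclosed : IsClosed (toWeakSpace ℝ X '' (M : Set X)) := by
    have h : toWeakSpace ℝ X '' closure (S : Set X) = closure (toWeakSpace ℝ X '' (S : Set X)) :=
      S.convex.toWeakSpace_closure ℝ
    change IsClosed (toWeakSpace ℝ X '' closure (S : Set X))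
    rw [h]
    exact isClosed_closure
  let K : Set (WeakSpace ℝ X) := toWeakSpace ℝ X '' C ∩ toWeakSpace ℝ X '' (M : Set X)
  have hK : CompactSpace K := isCompact_iff_compactSpace.1 (hC.inter_right hMclosed)
  obtain ⟨f, hf⟩ := hMsep.exists_dual_seq_separating
  have : TopologicalSpace.MetrizableSpace K := by
    refine Metric.PiNatEmbed.TopologicalSpace.MetrizableSpace.of_countable_separating
      (fun n (k : K) => f n ((toWeakSpace ℝ X).symm k))
      (fun n => (continuous_toWeakSpace_symm_apply (f n)).comp continuous_subtype_val) ?_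
    rintro ⟨_, _, a, ha, rfl⟩ ⟨_, _, b, hb, rfl⟩ hab
    by_contra! h
    have hab₀ : a - b = 0 := hf _ (M.sub_mem ha hb) fun n => by simpa [sub_eq_zero] using h n
    exact hab (Subtype.ext (congrArg (toWeakSpace ℝ X) (sub_eq_zero.1 hab₀)))
  have huM : ∀ n, u n ∈ M := fun n =>
    S.le_topologicalClosure (Submodule.subset_span (Set.mem_range_self n))
  let v : ℕ → K := fun n => ⟨toWeakSpace ℝ X (u n), ⟨u n, hu n, rfl⟩, ⟨u n, huM n, rfl⟩⟩
  obtain ⟨⟨_, ⟨y, hy, rfl⟩, _⟩, φ, hφ, hlim⟩ := CompactSpace.tendsto_subseq v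
  exact ⟨y, hy, φ, hφ, weakConvSeq_iff_tendsto_toWeakSpace.2
    ((continuous_subtype_val.tendsto _).comp hlim)⟩

theorem exists_norm_le_of_isCompact_toWeakSpace {C : Set X}
    (hC : IsCompact (toWeakSpace ℝ X '' C)) : ∃ R, ∀ x ∈ C, ‖x‖ ≤ R := by
  obtain ⟨R, hR⟩ := banach_steinhaus
    (g := fun x : C => NormedSpace.inclusionInDoubleDual ℝ X x) fun f => by
      obtain ⟨b, hb⟩ := (hC.image (continuous_toWeakSpace_symm_apply f)).isBounded.exists_norm_le
      exact ⟨b, fun x => hb _ ⟨_, ⟨x, x.2, rfl⟩, rfl⟩⟩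
  refine ⟨R, fun x hx => ?_⟩
  exact ((NormedSpace.inclusionInDoubleDualLi ℝ).norm_map x).symm.trans_le (hR ⟨x, hx⟩)

end WeakCompactness

/-- A sequence with vanishing consecutive differences, dominating each weighted mean of its next
two terms, converges. -/
theorem exists_tendsto_of_mean_le {a : ℕ → ℝ} {α₁ α₂ : ℝ} (ha : ∀ n, 0 ≤ a n) (hα₂ : 0 < α₂)
    (hα : α₁ + α₂ = 1) (hmean : ∀ n, α₁ * a (n + 1) + α₂ * a (n + 2) ≤ a n)
    (hdiff : Tendsto (fun n => a n - a (n + 1)) atTop (𝓝 0)) :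
    ∃ l, Tendsto a atTop (𝓝 l) := by
  let b : ℕ → ℝ := fun n => a n + α₂ * a (n + 1)
  have hb : Antitone b := antitone_nat_of_succ_le fun n => by
    have h : α₁ * a (n + 1) = a (n + 1) - α₂ * a (n + 1) := by rw [eq_sub_of_add_eq hα]; ring
    have := hmean n
    change a (n + 1) + α₂ * a (n + 2) ≤ a n + α₂ * a (n + 1)
    linarith
  have hbdd : BddBelow (Set.range b) := ⟨0, by
    rintro _ ⟨n, rfl⟩
    exact add_nonneg (ha n) (mul_nonneg hα₂.le (ha _))⟩
  have hlim := ((tendsto_atTop_ciInf hb hbdd).add (hdiff.const_mul α₂)).div_const (1 + α₂)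
  refine ⟨_, hlim.congr fun n => ?_⟩
  rw [div_eq_iff (by positivity)]
  ring

section MeanNonexpansive

variable {X : Type*} [NormedAddCommGroup X] {C : Set X} {T : X → X} {α₁ α₂ : ℝ} {x : X}

/-- If `u` and `T ∘ u` are approximate fixed point sequences, a weak limit of `u` in `C` is a fixed
point. -/
theorem OpialSet.isFixedPt_of_weakConvSeq [NormedSpace ℝ X] (hC : OpialSet C)
    (hα₁ : 0 < α₁) (hα₂ : 0 < α₂) (hα : α₁ + α₂ = 1)
    (hne : ∀ x ∈ C, ∀ y ∈ C, α₁ * ‖T x - T y‖ + α₂ * ‖T (T x) - T (T y)‖ ≤ ‖x - y‖)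
    {R : ℝ} (hR : ∀ x ∈ C, ‖x‖ ≤ R) {u : ℕ → X} (hu : ∀ n, u n ∈ C)
    (hu₁ : Tendsto (fun n => ‖u n - T (u n)‖) atTop (𝓝 0))
    (hu₂ : Tendsto (fun n => ‖T (u n) - T (T (u n))‖) atTop (𝓝 0))
    {y : X} (hy : y ∈ C) (huy : WeakConvSeq u y) : T y = y := by
  by_contra hTy
  let r : X → ℝ := fun v => liminf (fun n => ‖u n - v‖) atTop
  have hbelow : ∀ v, IsBoundedUnder (· ≥ ·) atTop fun n => ‖u n - v‖ := fun v =>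
    isBoundedUnder_of ⟨0, fun n => norm_nonneg _⟩
  have habove : ∀ v, IsBoundedUnder (· ≤ ·) atTop fun n => ‖u n - v‖ := fun v =>
    isBoundedUnder_of ⟨R + ‖v‖, fun n => (norm_sub_le _ _).trans (by gcongr; exact hR _ (hu n))⟩
  have h1 : r y < r (T y) := hC u y hu huy _ hTy
  have h2 : r y ≤ r (T (T y)) := by
    by_cases h : T (T y) = y
    · rw [h]
    · exact (hC u y hu huy _ h).le
  let ε := α₁ * (r (T y) - r y) / 4
  have hε : 0 < ε := div_pos (mul_pos hα₁ (sub_pos.2 h1)) four_pos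
  have e1 : ∀ᶠ n in atTop, r (T y) - ε < ‖u n - T y‖ :=
    eventually_lt_of_lt_liminf (sub_lt_self _ hε) (hbelow _)
  have e2 : ∀ᶠ n in atTop, r (T (T y)) - ε < ‖u n - T (T y)‖ :=
    eventually_lt_of_lt_liminf (sub_lt_self _ hε) (hbelow _)
  have hδ : Tendsto (fun n => ‖u n - T (u n)‖ + α₂ * ‖T (u n) - T (T (u n))‖) atTop (𝓝 0) := by
    simpa using hu₁.add (hu₂.const_mul α₂)
  have hev : ∀ᶠ n in atTop, r y + ε ≤ ‖u n - y‖ := by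
    filter_upwards [e1, e2, hδ.eventually_lt_const hε] with n h3 h4 h5
    have h6 : ‖u n - T y‖ ≤ ‖u n - T (u n)‖ + ‖T (u n) - T y‖ := norm_sub_le_norm_sub_add_norm_sub ..
    have h7 : ‖u n - T (T y)‖ ≤
        ‖u n - T (u n)‖ + ‖T (u n) - T (T (u n))‖ + ‖T (T (u n)) - T (T y)‖ := by
      linarith [norm_sub_le_norm_sub_add_norm_sub (u n) (T (u n)) (T (T y)),
        norm_sub_le_norm_sub_add_norm_sub (T (u n)) (T (T (u n))) (T (T y))]
    have h8 : α₁ * (r (T y) - ε) ≤ α₁ * (‖u n - T (u n)‖ + ‖T (u n) - T y‖) := by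
      gcongr; linarith
    have h9 : α₂ * (r y - ε) ≤
        α₂ * (‖u n - T (u n)‖ + ‖T (u n) - T (T (u n))‖ + ‖T (T (u n)) - T (T y)‖) := by
      gcongr; linarith
    have h10 := hne _ (hu n) _ hy
    have h11 : α₁ * (r (T y) - r y) = 4 * ε := by simp only [ε]; ring
    obtain rfl : α₁ = 1 - α₂ := by linarith
    nlinarith
  have : r y + ε ≤ r y := le_liminf_of_le (habove y).isCoboundedUnder_ge hev
  linarith

/-- In a set with the Opial property, a sequence whose distances to `p` and `q` converge cannot
have subsequences converging weakly to both unless `p = q`. -/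
theorem OpialSet.eq_of_weakConvSeq_subseq [NormedSpace ℝ X] (hC : OpialSet C) {u : ℕ → X}
    (hu : ∀ n, u n ∈ C)
    {p q : X} {lp lq : ℝ} (hp : Tendsto (fun n => ‖u n - p‖) atTop (𝓝 lp))
    (hq : Tendsto (fun n => ‖u n - q‖) atTop (𝓝 lq)) {φ ψ : ℕ → ℕ}
    (hφ : Tendsto φ atTop atTop) (hψ : Tendsto ψ atTop atTop)
    (hup : WeakConvSeq (fun n => u (φ n)) p) (huq : WeakConvSeq (fun n => u (ψ n)) q) : p = q := by
  by_contra hpq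
  have h1 := hC _ _ (fun n => hu (φ n)) hup q (Ne.symm hpq)
  have h2 := hC _ _ (fun n => hu (ψ n)) huq p hpq
  have h3 : lp < lq := (hp.comp hφ).liminf_eq ▸ (hq.comp hφ).liminf_eq ▸ h1
  have h4 : lq < lp := (hp.comp hψ).liminf_eq ▸ (hq.comp hψ).liminf_eq ▸ h2
  exact lt_asymm h3 h4

/-- The distances from an asymptotically regular orbit to a fixed point converge. -/
theorem exists_tendsto_norm_iterate_sub (hT : Set.MapsTo T C C) (hα₂ : 0 < α₂) (hα : α₁ + α₂ = 1)
    (hne : ∀ x ∈ C, ∀ y ∈ C, α₁ * ‖T x - T y‖ + α₂ * ‖T (T x) - T (T y)‖ ≤ ‖x - y‖)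
    (hx : x ∈ C) (har : Tendsto (fun n => ‖T^[n] x - T^[n + 1] x‖) atTop (𝓝 0))
    {p : X} (hp : p ∈ C) (hTp : T p = p) :
    ∃ l, Tendsto (fun n => ‖T^[n] x - p‖) atTop (𝓝 l) := by
  refine exists_tendsto_of_mean_le (fun n => norm_nonneg _) hα₂ hα (fun n => ?_)
    (squeeze_zero_norm (fun n => ?_) har)
  · simpa only [Function.iterate_succ_apply', hTp] using hne _ (hT.iterate n hx) p hp
  · simpa using abs_norm_sub_norm_le (T^[n] x - p) (T^[n + 1] x - p)

end MeanNonexpansive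

theorem weak_convergence_of_mean_nonexpansive_two
    {X : Type*} [NormedAddCommGroup X] [NormedSpace ℝ X] [CompleteSpace X]
    (C : Set X) (hC_wcompact : IsCompact (toWeakSpace ℝ X '' C))
    (hC_convex : Convex ℝ C) (hC_opial : OpialSet C)
    (T : X → X) (hT : Set.MapsTo T C C)
    (α₁ α₂ : ℝ) (hα₁ : 0 < α₁) (hα₂ : 0 < α₂) (hα : α₁ + α₂ = 1)
    (hne : ∀ x ∈ C, ∀ y ∈ C,
      α₁ * ‖T x - T y‖ + α₂ * ‖T (T x) - T (T y)‖ ≤ ‖x - y‖)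
    (x : X) (hx : x ∈ C)
    (har : Filter.Tendsto (fun n => ‖T^[n] x - T^[n + 1] x‖) Filter.atTop (nhds 0)) :
    ∃ y ∈ C, T y = y ∧ WeakConvSeq (fun n => T^[n] x) y := by
  have horb : ∀ n, T^[n] x ∈ C := fun n => hT.iterate n hx
  obtain ⟨R, hR⟩ := exists_norm_le_of_isCompact_toWeakSpace hC_wcompact
  have hfix : ∀ φ : ℕ → ℕ, Tendsto φ atTop atTop → ∀ y ∈ C,
      WeakConvSeq (fun n => T^[φ n] x) y → T y = y := fun φ hφ y hy hconv => by
    refine hC_opial.isFixedPt_of_weakConvSeq hα₁ hα₂ hα hne hR (fun n => horb (φ n))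
      ?_ ?_ hy hconv
    · simpa only [Function.iterate_succ_apply', Function.comp_def] using har.comp hφ
    · simpa only [Function.iterate_succ_apply', Function.comp_def] using
        har.comp ((tendsto_add_atTop_nat 1).comp hφ)
  have hlim : ∀ y ∈ C, T y = y → ∃ l, Tendsto (fun n => ‖T^[n] x - y‖) atTop (𝓝 l) :=
    fun y hy hTy => exists_tendsto_norm_iterate_sub hT hα₂ hα hne hx har hy hTy
  obtain ⟨y, hy, φ, hφ, hconv⟩ := exists_subseq_weakConvSeq hC_wcompact horb
  have hTy := hfix φ hφ.tendsto_atTop y hy hconv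
  refine ⟨y, hy, hTy, weakConvSeq_iff_tendsto_toWeakSpace.2
    (tendsto_of_subseq_tendsto fun ns hns => ?_)⟩
  obtain ⟨z, hz, ψ, hψ, hconv'⟩ := exists_subseq_weakConvSeq hC_wcompact fun n => horb (ns n)
  have hnsψ := hns.comp hψ.tendsto_atTop
  obtain ⟨ly, hly⟩ := hlim y hy hTy
  obtain ⟨lz, hlz⟩ := hlim z hz (hfix _ hnsψ z hz hconv')
  obtain rfl := hC_opial.eq_of_weakConvSeq_subseq horb hly hlz hφ.tendsto_atTop hnsψ hconv hconv'
  exact ⟨ψ, weakConvSeq_iff_tendsto_toWeakSpace.1 hconv'⟩
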